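/- arXiv:2002.04126 — 5 statements merged into one kernel-verified Lean document; each statement's English description precedes it below -/
import Mathlib

section
/- Let A be a real m×n matrix with nonzero rows, b ∈ ℝ^m, and x⋆ a least-squares solution (Aᵀ(b − A x⋆) = 0) with residual r⋆ = b − A x⋆. Suppose P W D⁻² = (α/‖A‖_F²) I for some α > 0, where D = Diag(‖A₁‖,…,‖A_m‖), P = Diag(p₁,…,p_m) with p a probability vector, and W = Diag(w₁,…,w_m). Fix q ≥ 1 and x ∈ ℝ^n with error e = x − x⋆ and residual r = b − A x, and for τ : Fin q → Fin m let x'_τ = x − (1/q) Σ_{j ∈ Fin q} w_{τ(j)} ((A_{τ(j)} · x − b_{τ(j)})/‖A_{τ(j)}‖²) A_{τ(j)}ᵀ. Then the expected squared error satisfies the exact identity Σ_{τ} (Π_j p_{τ(j)}) ‖x'_τ − x⋆‖² = ⟨e, ((I − α AᵀA/‖A‖_F²)² − (α²/q)(AᵀA/‖A‖_F²)²) e⟩ + (α/q) ⟨r, W r⟩ / ‖A‖_F². -/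
open Matrix BigOperators

theorem kacz_moment {m : ℕ} (p g : Fin m → ℝ) (hp1 : ∑ i, p i = 1) (q : ℕ) : ∀ c : ℝ,
    ∑ τ : Fin q → Fin m, (∏ j, p (τ j)) * (c - ∑ j, g (τ j)) ^ 2 =
      (c - q * ∑ i, p i * g i) ^ 2 + q * (∑ i, p i * g i ^ 2 - (∑ i, p i * g i) ^ 2) := by
  induction q with
  | zero => intro c; simp
  | succ q ih =>
    intro c
    rw [← (Fin.consEquiv (fun _ : Fin (q + 1) => Fin m)).sum_comp, Fintype.sum_prod_type]
    have h : ∀ i : Fin m, ∑ τ : Fin q → Fin m,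
        (∏ j, p ((Fin.consEquiv (fun _ : Fin (q + 1) => Fin m)) (i, τ) j)) *
          (c - ∑ j, g ((Fin.consEquiv (fun _ : Fin (q + 1) => Fin m)) (i, τ) j)) ^ 2
        = p i * ((c - g i - q * ∑ i, p i * g i) ^ 2
          + q * (∑ i, p i * g i ^ 2 - (∑ i, p i * g i) ^ 2)) := by
      intro i
      rw [← ih (c - g i), Finset.mul_sum]
      refine Finset.sum_congr rfl fun τ _ => ?_
      simp only [Fin.consEquiv_apply, Fin.prod_univ_succ, Fin.sum_univ_succ, Fin.cons_zero,
        Fin.cons_succ]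
      ring
    rw [Finset.sum_congr rfl fun i _ => h i]
    generalize hμ : ∑ i, p i * g i = μ
    generalize hs : ∑ i, p i * g i ^ 2 = s
    have h2 : ∀ i, p i * ((c - g i - q * μ) ^ 2 + q * (s - μ ^ 2))
        = ((c - q * μ) ^ 2 + q * (s - μ ^ 2)) * p i - 2 * (c - q * μ) * (p i * g i)
          + p i * g i ^ 2 := by intro i; ring
    simp only [h2, Finset.sum_add_distrib, Finset.sum_sub_distrib, ← Finset.mul_sum, hμ, hs, hp1]
    push_cast
    ring

theorem kacz_scalar {m : ℕ} (p f : Fin m → ℝ) (hp1 : ∑ i, p i = 1) (q : ℕ) (hq : 1 ≤ q) (c : ℝ) :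
    ∑ τ : Fin q → Fin m, (∏ j, p (τ j)) * (c - (q : ℝ)⁻¹ * ∑ j, f (τ j)) ^ 2 =
      (c - ∑ i, p i * f i) ^ 2 - (q : ℝ)⁻¹ * (∑ i, p i * f i) ^ 2
        + (q : ℝ)⁻¹ * ∑ i, p i * f i ^ 2 := by
  have hq0 : (q : ℝ) ≠ 0 := by positivity
  have h := kacz_moment p (fun i => (q : ℝ)⁻¹ * f i) hp1 q c
  have h1 : ∑ i, p i * ((q : ℝ)⁻¹ * f i) = (q : ℝ)⁻¹ * ∑ i, p i * f i := by
    rw [Finset.mul_sum]; exact Finset.sum_congr rfl fun i _ => by ring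
  have h2 : ∑ i, p i * ((q : ℝ)⁻¹ * f i) ^ 2 = (q : ℝ)⁻¹ ^ 2 * ∑ i, p i * f i ^ 2 := by
    rw [Finset.mul_sum]; exact Finset.sum_congr rfl fun i _ => by ring
  simp only [h1, h2, ← Finset.mul_sum] at h
  rw [h]
  field_simp
  ring

/-- Exact identity for the expected squared error of one averaged randomized
Kaczmarz step under the coupling condition `P W D⁻² = (α/‖A‖_F²) I`:
`E‖x' − x⋆‖² = ⟨e, ((I − α AᵀA/‖A‖_F²)² − (α²/q)(AᵀA/‖A‖_F²)²) e⟩ + (α/q)⟨r, W r⟩/‖A‖_F²`. -/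
theorem averaged_kaczmarz_expected_error_identity
    {m n : ℕ} (A : Matrix (Fin m) (Fin n) ℝ) (hrows : ∀ i : Fin m, A i ≠ 0)
    (b : Fin m → ℝ) (xstar : Fin n → ℝ)
    (hxstar : Aᵀ.mulVec (b - A.mulVec xstar) = 0)
    (w p : Fin m → ℝ) (hp0 : ∀ i, 0 ≤ p i) (hp1 : ∑ i, p i = 1)
    (F : ℝ) (hF : F = ∑ i, ∑ j, A i j ^ 2)
    (D P W : Matrix (Fin m) (Fin m) ℝ)
    (hD : D = Matrix.diagonal (fun i => Real.sqrt (∑ l, A i l ^ 2)))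
    (hP : P = Matrix.diagonal p) (hW : W = Matrix.diagonal w)
    (α : ℝ) (hα : 0 < α)
    (hcouple : P * W * (D ^ 2)⁻¹ = (α / F) • (1 : Matrix (Fin m) (Fin m) ℝ))
    (q : ℕ) (hq : 1 ≤ q) (x : Fin n → ℝ)
    (x' : (Fin q → Fin m) → Fin n → ℝ)
    (hx' : ∀ τ, x' τ = x - (q : ℝ)⁻¹ •
      (∑ j : Fin q, (w (τ j) * ((∑ l, A (τ j) l * x l) - b (τ j)) / (∑ l, A (τ j) l ^ 2)) •
        A (τ j))) :
    ∑ τ : Fin q → Fin m, (∏ j, p (τ j)) * (∑ i, (x' τ i - xstar i) ^ 2) =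
      (x - xstar) ⬝ᵥ ((((1 : Matrix (Fin n) (Fin n) ℝ) - (α / F) • (Aᵀ * A)) ^ 2
          - (α ^ 2 / (q : ℝ)) • (F⁻¹ • (Aᵀ * A)) ^ 2).mulVec (x - xstar))
        + (α / (q : ℝ)) * ((b - A.mulVec x) ⬝ᵥ W.mulVec (b - A.mulVec x)) / F := by
  have hN : ∀ i, 0 < ∑ l, A i l ^ 2 := by
    intro i
    obtain ⟨l, hl⟩ := Function.ne_iff.mp (hrows i)
    exact Finset.sum_pos' (fun l _ => sq_nonneg _)
      ⟨l, Finset.mem_univ _, by have : A i l ≠ 0 := hl; positivity⟩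
  have hc : ∀ i, p i * w i = α / F * ∑ l, A i l ^ 2 := by
    have hD2 : D ^ 2 = Matrix.diagonal (fun i => ∑ l, A i l ^ 2) := by
      rw [hD, Matrix.diagonal_pow]
      congr 1
      funext i
      simp [Real.sq_sqrt (hN i).le]
    have hu : IsUnit (D ^ 2).det := by
      rw [hD2, Matrix.det_diagonal]
      exact (Finset.prod_ne_zero_iff.mpr fun i _ => (hN i).ne').isUnit
    have h := congrArg (· * D ^ 2) hcouple
    simp only [Matrix.nonsing_inv_mul_cancel_right _ _ hu] at h
    intro i
    have hi := congrFun (congrFun h i) i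
    rw [hD2, hP, hW] at hi
    simpa using hi
  set f : Fin m → ℝ := fun i => w i * ((∑ l, A i l * x l) - b i) / (∑ l, A i l ^ 2) with hf
  set G : Matrix (Fin n) (Fin n) ℝ := Aᵀ * A with hG
  set e := x - xstar with he
  -- residual
  have hr : ∀ i, (∑ l, A i l * x l) - b i = - (b - A *ᵥ x) i := by
    intro i; simp [Matrix.mulVec, dotProduct]
  have hGe : G *ᵥ e = - (Aᵀ *ᵥ (b - A *ᵥ x)) := by
    have : b - A *ᵥ x = (b - A *ᵥ xstar) - A *ᵥ e := by
      rw [he, Matrix.mulVec_sub]; abel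
    rw [this, Matrix.mulVec_sub Aᵀ, hxstar, hG, Matrix.mulVec_mulVec]; simp
  have hmean : ∀ k, ∑ i, p i * (f i * A i k) = α / F * (G *ᵥ e) k := by
    intro k
    rw [hGe]
    simp only [Pi.neg_apply, Matrix.mulVec, dotProduct, Matrix.transpose_apply]
    rw [← Finset.sum_neg_distrib, Finset.mul_sum]
    refine Finset.sum_congr rfl fun i _ => ?_
    have h1 := hc i
    have h2 := (hN i).ne'
    have h3 : p i * f i = α / F * ((∑ l, A i l * x l) - b i) := by
      simp only [hf]
      rw [mul_div_assoc, ← mul_assoc, h1]; field_simp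
    rw [← mul_assoc, h3, hr]
    simp [Matrix.mulVec, dotProduct]; ring
  have hsec : ∑ k, ∑ i, p i * (f i * A i k) ^ 2
      = α / F * ((b - A *ᵥ x) ⬝ᵥ W *ᵥ (b - A *ᵥ x)) := by
    rw [Finset.sum_comm, hW]
    simp only [dotProduct, Matrix.mulVec_diagonal]
    rw [Finset.mul_sum]
    refine Finset.sum_congr rfl fun i _ => ?_
    have h1 := hc i
    have h2 := (hN i).ne'
    have h4 : ∑ k, p i * (f i * A i k) ^ 2 = p i * f i * f i * ∑ l, A i l ^ 2 := by
      rw [Finset.mul_sum]; exact Finset.sum_congr rfl fun k _ => by ring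
    have h3 : p i * f i = α / F * ((∑ l, A i l * x l) - b i) := by
      simp only [hf]
      rw [mul_div_assoc, ← mul_assoc, h1]; field_simp
    have h5 : f i * ∑ l, A i l ^ 2 = w i * ((∑ l, A i l * x l) - b i) := by
      simp only [hf]; field_simp
    rw [h4, mul_assoc, h5, h3, hr]; ring
  have hL : ∑ τ : Fin q → Fin m, (∏ j, p (τ j)) * (∑ i, (x' τ i - xstar i) ^ 2)
      = ∑ k, ∑ τ : Fin q → Fin m, (∏ j, p (τ j)) *
          (e k - (q : ℝ)⁻¹ * ∑ j, (fun i => f i * A i k) (τ j)) ^ 2 := by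
    rw [Finset.sum_comm]
    refine Finset.sum_congr rfl fun τ _ => ?_
    rw [Finset.mul_sum]
    refine Finset.sum_congr rfl fun k _ => ?_
    rw [hx' τ]
    simp only [Pi.sub_apply, Pi.smul_apply, Finset.sum_apply, smul_eq_mul, he, hf]
    ring
  rw [hL, Finset.sum_congr rfl fun k _ => kacz_scalar p (fun i => f i * A i k) hp1 q hq (e k)]
  simp only [hmean]
  rw [Finset.sum_add_distrib, ← Finset.mul_sum, hsec]
  have hGT : Gᵀ = G := by rw [hG]; simp
  have hGG : e ⬝ᵥ (G * G) *ᵥ e = (G *ᵥ e) ⬝ᵥ (G *ᵥ e) := by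
    rw [← Matrix.mulVec_mulVec, Matrix.dotProduct_mulVec, ← Matrix.mulVec_transpose, hGT]
  have hquad : e ⬝ᵥ ((((1 : Matrix (Fin n) (Fin n) ℝ) - (α / F) • G) ^ 2
          - (α ^ 2 / (q : ℝ)) • (F⁻¹ • G) ^ 2) *ᵥ e)
      = e ⬝ᵥ e - 2 * (α / F) * (e ⬝ᵥ G *ᵥ e) + ((α / F) ^ 2 - α ^ 2 / q * F⁻¹ ^ 2)
          * ((G *ᵥ e) ⬝ᵥ (G *ᵥ e)) := by
    have : (((1 : Matrix (Fin n) (Fin n) ℝ) - (α / F) • G) ^ 2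
          - (α ^ 2 / (q : ℝ)) • (F⁻¹ • G) ^ 2)
        = 1 - (2 * (α / F)) • G + ((α / F) ^ 2 - α ^ 2 / q * F⁻¹ ^ 2) • (G * G) := by
      simp only [pow_two, sub_mul, mul_sub, one_mul, mul_one, smul_mul_assoc, mul_smul_comm]
      module
    rw [this, ← hGG]
    simp [Matrix.add_mulVec, Matrix.sub_mulVec, Matrix.smul_mulVec]
  rw [hquad]
  have hsum : ∑ k, ((e k - α / F * (G *ᵥ e) k) ^ 2 - (q : ℝ)⁻¹ * (α / F * (G *ᵥ e) k) ^ 2)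
      = e ⬝ᵥ e - 2 * (α / F) * (e ⬝ᵥ G *ᵥ e) + ((α / F) ^ 2 - α ^ 2 / q * F⁻¹ ^ 2)
          * ((G *ᵥ e) ⬝ᵥ (G *ᵥ e)) := by
    generalize G *ᵥ e = g
    simp only [dotProduct, Finset.mul_sum, ← Finset.sum_add_distrib, ← Finset.sum_sub_distrib]
    refine Finset.sum_congr rfl fun k _ => ?_
    ring
  rw [hsum]
  ring
end

section
/- Let A be a real m×n matrix with nonzero rows, b ∈ ℝ^m, and x⋆ a least-squares solution (Aᵀ(b − A x⋆) = 0). Suppose P W D⁻² = (α/‖A‖_F²) I for some α > 0, where D = Diag(‖A₁‖,…,‖A_m‖), P = Diag(p₁,…,p_m) with p a probability vector, and W = Diag(w₁,…,w_m). Fix q ≥ 1 and x ∈ ℝ^n with error e = x − x⋆ and residual r = b − A x, and for τ : Fin q → Fin m let x'_τ = x − (1/q) Σ_{j ∈ Fin q} w_{τ(j)} ((A_{τ(j)} · x − b_{τ(j)})/‖A_{τ(j)}‖²) A_{τ(j)}ᵀ. Then Σ_{τ} (Π_j p_{τ(j)}) ‖x'_τ − x⋆‖² ≤ λ_max((I −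 α AᵀA/‖A‖_F²)² − (α²/q)(AᵀA/‖A‖_F²)²) · ‖e‖² + (α/q) ⟨r, W r⟩ / ‖A‖_F², where λ_max denotes the largest eigenvalue of the symmetric matrix. -/
open Matrix BigOperators

/-- The largest eigenvalue of a symmetric matrix, as the supremum of the quadratic form
`⟨v, B v⟩` over Euclidean unit vectors `v`. -/
noncomputable def lambdaMax {k : ℕ} (B : Matrix (Fin k) (Fin k) ℝ) : ℝ :=
  sSup {t : ℝ | ∃ v : Fin k → ℝ, (∑ i, v i ^ 2) = 1 ∧ v ⬝ᵥ B.mulVec v = t}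

theorem akz_moments {m : ℕ} (p g : Fin m → ℝ) (hp1 : ∑ i, p i = 1) (q : ℕ) :
    (∑ τ : Fin q → Fin m, (∏ j, p (τ j)) = 1) ∧
    (∑ τ : Fin q → Fin m, (∏ j, p (τ j)) * (∑ j, g (τ j)) = q * ∑ i, p i * g i) ∧
    (∑ τ : Fin q → Fin m, (∏ j, p (τ j)) * (∑ j, g (τ j)) ^ 2
      = q * ∑ i, p i * g i ^ 2 + q * (q - 1) * (∑ i, p i * g i) ^ 2) := by
  induction q with
  | zero => simp
  | succ q ih =>
    obtain ⟨h0, h1, h2⟩ := ih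
    have key : ∀ f : (Fin (q + 1) → Fin m) → ℝ,
        ∑ τ, f τ = ∑ i, ∑ τ : Fin q → Fin m, f (Fin.cons i τ) := by
      intro f
      rw [← (Fin.consEquiv (fun _ : Fin (q + 1) => Fin m)).sum_comp f, Fintype.sum_prod_type]
      rfl
    refine ⟨?_, ?_, ?_⟩
    · rw [key]
      simp only [Fin.prod_univ_succ, Fin.cons_zero, Fin.cons_succ]
      simp only [← Finset.mul_sum, h0, mul_one, hp1]
    · rw [key]
      simp only [Fin.prod_univ_succ, Fin.sum_univ_succ, Fin.cons_zero, Fin.cons_succ]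
      have : ∀ i, ∑ τ : Fin q → Fin m, (p i * ∏ j, p (τ j)) * (g i + ∑ j, g (τ j))
          = p i * g i + p i * (q * ∑ i, p i * g i) := by
        intro i
        rw [← h1, ← mul_one (p i * g i), ← h0, Finset.mul_sum, Finset.mul_sum,
          ← Finset.sum_add_distrib]
        exact Finset.sum_congr rfl fun τ _ => by ring
      simp only [this]
      rw [Finset.sum_add_distrib, ← Finset.sum_mul, hp1]
      push_cast; ring
    · rw [key]
      simp only [Fin.prod_univ_succ, Fin.sum_univ_succ, Fin.cons_zero, Fin.cons_succ]
      have : ∀ i, ∑ τ : Fin q → Fin m, (p i * ∏ j, p (τ j)) * (g i + ∑ j, g (τ j)) ^ 2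
          = p i * g i ^ 2 + p i * g i * (2 * (q * ∑ i, p i * g i)) +
            p i * (q * ∑ i, p i * g i ^ 2 + q * (q - 1) * (∑ i, p i * g i) ^ 2) := by
        intro i
        rw [← h2, ← h1, ← mul_one (p i * g i ^ 2), ← h0, Finset.mul_sum, Finset.mul_sum,
          Finset.mul_sum, Finset.mul_sum, ← Finset.sum_add_distrib, ← Finset.sum_add_distrib]
        exact Finset.sum_congr rfl fun τ _ => by ring
      simp only [this]
      rw [Finset.sum_add_distrib, Finset.sum_add_distrib, ← Finset.sum_mul, ← Finset.sum_mul, hp1]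
      push_cast; ring

theorem akz_scalar {m : ℕ} (p g : Fin m → ℝ) (hp1 : ∑ i, p i = 1) (q : ℕ) (hq : 1 ≤ q) (a : ℝ) :
    ∑ τ : Fin q → Fin m, (∏ j, p (τ j)) * (a - (q : ℝ)⁻¹ * ∑ j, g (τ j)) ^ 2
      = (a - ∑ i, p i * g i) ^ 2 - (q : ℝ)⁻¹ * (∑ i, p i * g i) ^ 2
        + (q : ℝ)⁻¹ * ∑ i, p i * g i ^ 2 := by
  obtain ⟨h0, h1, h2⟩ := akz_moments p g hp1 q
  have hq' : (q : ℝ) ≠ 0 := by positivity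
  have : ∑ τ : Fin q → Fin m, (∏ j, p (τ j)) * (a - (q : ℝ)⁻¹ * ∑ j, g (τ j)) ^ 2
      = a ^ 2 * ∑ τ : Fin q → Fin m, (∏ j, p (τ j))
        - 2 * a * (q : ℝ)⁻¹ * ∑ τ : Fin q → Fin m, (∏ j, p (τ j)) * (∑ j, g (τ j))
        + ((q : ℝ)⁻¹) ^ 2 * ∑ τ : Fin q → Fin m, (∏ j, p (τ j)) * (∑ j, g (τ j)) ^ 2 := by
    rw [Finset.mul_sum, Finset.mul_sum, Finset.mul_sum, ← Finset.sum_sub_distrib,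
      ← Finset.sum_add_distrib]
    exact Finset.sum_congr rfl fun τ _ => by ring
  rw [this, h0, h1, h2]
  field_simp
  ring

theorem akz_quad {k : ℕ} (B : Matrix (Fin k) (Fin k) ℝ) (v : Fin k → ℝ) :
    v ⬝ᵥ B.mulVec v ≤ lambdaMax B * ∑ i, v i ^ 2 := by
  have hbdd : BddAbove {t : ℝ | ∃ v : Fin k → ℝ, (∑ i, v i ^ 2) = 1 ∧ v ⬝ᵥ B.mulVec v = t} := by
    refine ⟨∑ i, ∑ j, |B i j|, ?_⟩
    rintro t ⟨u, hu, rfl⟩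
    have hu1 : ∀ i, |u i| ≤ 1 := by
      intro i
      rw [← sq_le_one_iff_abs_le_one, ← hu]
      exact Finset.single_le_sum (f := fun i => u i ^ 2) (fun j _ => sq_nonneg _)
        (Finset.mem_univ i)
    simp only [dotProduct, Matrix.mulVec, Finset.mul_sum]
    refine Finset.sum_le_sum fun i _ => Finset.sum_le_sum fun j _ => ?_
    refine (le_abs_self _).trans ?_
    rw [abs_mul, abs_mul]
    have h1 : |B i j| * |u j| ≤ |B i j| := mul_le_of_le_one_right (abs_nonneg _) (hu1 j)
    exact (mul_le_of_le_one_left (by positivity) (hu1 i)).trans h1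
  have hs : 0 ≤ ∑ i, v i ^ 2 := Finset.sum_nonneg fun i _ => sq_nonneg _
  rcases hs.eq_or_lt with h | h
  · have hv : v = 0 := by
      funext i
      have := (Finset.sum_eq_zero_iff_of_nonneg (fun i _ => sq_nonneg (v i))).1 h.symm i
        (Finset.mem_univ i)
      simpa using this
    simp [hv]
  · set s := ∑ i, v i ^ 2 with hsdef
    have hr : Real.sqrt s ^ 2 = s := Real.sq_sqrt hs
    have hle := le_csSup hbdd (a := s⁻¹ * (v ⬝ᵥ B.mulVec v)) ⟨(Real.sqrt s)⁻¹ • v, by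
      simp only [Pi.smul_apply, smul_eq_mul, mul_pow, ← Finset.mul_sum, inv_pow, hr]
      rw [← hsdef]
      exact inv_mul_cancel₀ h.ne', by
      rw [Matrix.mulVec_smul, smul_dotProduct, dotProduct_smul, smul_eq_mul, smul_eq_mul,
        ← mul_assoc, ← mul_inv, ← sq, hr]⟩
    change _ ≤ lambdaMax B at hle
    rw [inv_mul_le_iff₀ h] at hle
    linarith

/-- Expected squared error bound for one averaged randomized Kaczmarz step
under the coupling condition `P W D⁻² = (α/‖A‖_F²) I`:
`E‖x' − x⋆‖² ≤ λ_max((I − α AᵀA/‖A‖_F²)² − (α²/q)(AᵀA/‖A‖_F²)²) ‖e‖² + (α/q)⟨r, W r⟩/‖A‖_F²`. -/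
theorem averaged_kaczmarz_expected_error_bound
    {m n : ℕ} (A : Matrix (Fin m) (Fin n) ℝ) (hrows : ∀ i : Fin m, A i ≠ 0)
    (b : Fin m → ℝ) (xstar : Fin n → ℝ)
    (hxstar : Aᵀ.mulVec (b - A.mulVec xstar) = 0)
    (w p : Fin m → ℝ) (hp0 : ∀ i, 0 ≤ p i) (hp1 : ∑ i, p i = 1)
    (F : ℝ) (hF : F = ∑ i, ∑ j, A i j ^ 2)
    (D P W : Matrix (Fin m) (Fin m) ℝ)
    (hD : D = Matrix.diagonal (fun i => Real.sqrt (∑ l, A i l ^ 2)))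
    (hP : P = Matrix.diagonal p) (hW : W = Matrix.diagonal w)
    (α : ℝ) (hα : 0 < α)
    (hcouple : P * W * (D ^ 2)⁻¹ = (α / F) • (1 : Matrix (Fin m) (Fin m) ℝ))
    (q : ℕ) (hq : 1 ≤ q) (x : Fin n → ℝ)
    (x' : (Fin q → Fin m) → Fin n → ℝ)
    (hx' : ∀ τ, x' τ = x - (q : ℝ)⁻¹ •
      (∑ j : Fin q, (w (τ j) * ((∑ l, A (τ j) l * x l) - b (τ j)) / (∑ l, A (τ j) l ^ 2)) •
        A (τ j))) :
    ∑ τ : Fin q → Fin m, (∏ j, p (τ j)) * (∑ i, (x' τ i - xstar i) ^ 2) ≤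
      lambdaMax (((1 : Matrix (Fin n) (Fin n) ℝ) - (α / F) • (Aᵀ * A)) ^ 2
          - (α ^ 2 / (q : ℝ)) • (F⁻¹ • (Aᵀ * A)) ^ 2) * (∑ i, (x i - xstar i) ^ 2)
        + (α / (q : ℝ)) * ((b - A.mulVec x) ⬝ᵥ W.mulVec (b - A.mulVec x)) / F := by
  have hN : ∀ i, 0 < ∑ l, A i l ^ 2 := by
    intro i
    obtain ⟨l, hl⟩ := Function.ne_iff.1 (hrows i)
    exact Finset.sum_pos' (fun _ _ => sq_nonneg _) ⟨l, Finset.mem_univ _, by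
      have : A i l ≠ 0 := hl
      positivity⟩
  have hD2 : D ^ 2 = Matrix.diagonal (fun i => ∑ l, A i l ^ 2) := by
    rw [hD, Matrix.diagonal_pow]
    congr 1
    funext i
    exact Real.sq_sqrt (hN i).le
  have hdet : IsUnit (D ^ 2).det := by
    rw [hD2, Matrix.det_diagonal]
    exact (Finset.prod_pos fun i _ => hN i).ne'.isUnit
  have hc : ∀ i, p i * w i = α / F * ∑ l, A i l ^ 2 := by
    intro i
    have h := congrArg (fun M => M * D ^ 2) hcouple
    simp only [Matrix.mul_assoc, Matrix.nonsing_inv_mul _ hdet, Matrix.mul_one, smul_mul_assoc,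
      one_mul] at h
    rw [hD2, hP, hW, Matrix.diagonal_mul_diagonal] at h
    have := congrFun (congrFun h i) i
    simpa using this
  set r : Fin m → ℝ := b - A.mulVec x with hr
  set e : Fin n → ℝ := x - xstar with he
  set G : Matrix (Fin n) (Fin n) ℝ := Aᵀ * A with hG
  set c : Fin m → ℝ := fun i =>
    w i * ((∑ l, A i l * x l) - b i) / (∑ l, A i l ^ 2) with hcdef
  have hri : ∀ i, (∑ l, A i l * x l) - b i = - r i := by
    intro i; simp [hr, Matrix.mulVec, dotProduct]
  have hpc : ∀ i, p i * c i = - (α / F) * r i := by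
    intro i
    simp only [hcdef, hri]
    have := hc i
    have h0 := (hN i).ne'
    rw [← mul_div_assoc, ← mul_assoc, this]
    field_simp
  have hAr : Aᵀ.mulVec r = - G.mulVec e := by
    have : r = (b - A.mulVec xstar) - A.mulVec e := by
      rw [hr, he, Matrix.mulVec_sub]; abel
    rw [this, Matrix.mulVec_sub, hxstar, Matrix.mulVec_mulVec, zero_sub]
  have hmu : ∀ l, ∑ i, p i * (c i * A i l) = α / F * G.mulVec e l := by
    intro l
    have h1 := congrFun hAr l
    simp only [Pi.neg_apply] at h1
    rw [← neg_neg (G.mulVec e l), ← h1]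
    simp only [Matrix.mulVec, dotProduct, Matrix.transpose_apply, ← mul_assoc, hpc]
    rw [← Finset.sum_neg_distrib, Finset.mul_sum]
    exact Finset.sum_congr rfl fun i _ => by ring
  have hs : ∑ l, ∑ i, p i * (c i * A i l) ^ 2 = α / F * (r ⬝ᵥ W.mulVec r) := by
    rw [Finset.sum_comm, hW]
    simp only [dotProduct, Matrix.mulVec_diagonal, Finset.mul_sum]
    refine Finset.sum_congr rfl fun i _ => ?_
    have h0 := (hN i).ne'
    have h1 : c i * (∑ l, A i l ^ 2) = - (w i * r i) := by
      simp only [hcdef, hri]; field_simp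
    calc ∑ l, p i * (c i * A i l) ^ 2 = (p i * c i) * (c i * ∑ l, A i l ^ 2) := by
          rw [Finset.mul_sum, Finset.mul_sum]
          exact Finset.sum_congr rfl fun l _ => by ring
      _ = _ := by rw [h1, hpc]; ring
  have hlhs : ∑ τ : Fin q → Fin m, (∏ j, p (τ j)) * (∑ i, (x' τ i - xstar i) ^ 2)
      = ∑ l, ((e l - α / F * G.mulVec e l) ^ 2 - (q : ℝ)⁻¹ * (α / F * G.mulVec e l) ^ 2)
        + (q : ℝ)⁻¹ * (α / F * (r ⬝ᵥ W.mulVec r)) := by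
    rw [← hs, Finset.mul_sum, ← Finset.sum_add_distrib]
    simp only [Finset.mul_sum (s := (Finset.univ : Finset (Fin n)))]
    rw [Finset.sum_comm]
    refine Finset.sum_congr rfl fun l _ => ?_
    rw [← hmu l, ← akz_scalar p (fun i => c i * A i l) hp1 q hq (e l)]
    refine Finset.sum_congr rfl fun τ _ => ?_
    rw [hx' τ]
    simp only [Pi.sub_apply, Pi.smul_apply, Finset.sum_apply, smul_eq_mul, he, hcdef]
    ring
  have hGs : ∀ u v : Fin n → ℝ, u ⬝ᵥ G.mulVec v = G.mulVec u ⬝ᵥ v := by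
    intro u v
    have hT : Gᵀ = G := by simp [hG]
    rw [Matrix.dotProduct_mulVec, ← Matrix.mulVec_transpose, hT]
  have hq0 : e ⬝ᵥ (((1 : Matrix (Fin n) (Fin n) ℝ) - (α / F) • G) ^ 2
          - (α ^ 2 / (q : ℝ)) • (F⁻¹ • G) ^ 2).mulVec e
      = ∑ l, ((e l - α / F * G.mulVec e l) ^ 2 - (q : ℝ)⁻¹ * (α / F * G.mulVec e l) ^ 2) := by
    have h1 : ∑ l, ((e l - α / F * G.mulVec e l) ^ 2 - (q : ℝ)⁻¹ * (α / F * G.mulVec e l) ^ 2)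
        = e ⬝ᵥ e - 2 * (α / F) * (G.mulVec e ⬝ᵥ e)
          + (1 - (q : ℝ)⁻¹) * (α / F) ^ 2 * (G.mulVec e ⬝ᵥ G.mulVec e) := by
      simp only [dotProduct, Finset.mul_sum]
      rw [← Finset.sum_sub_distrib, ← Finset.sum_add_distrib]
      exact Finset.sum_congr rfl fun l _ => by ring
    rw [h1]
    simp only [sq (_ : Matrix (Fin n) (Fin n) ℝ), Matrix.sub_mulVec, Matrix.smul_mulVec,
      ← Matrix.mulVec_mulVec, Matrix.one_mulVec, Matrix.mulVec_sub, Matrix.mulVec_smul,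
      dotProduct_sub, dotProduct_smul, smul_eq_mul, hGs]
    ring
  have hfin := akz_quad (((1 : Matrix (Fin n) (Fin n) ℝ) - (α / F) • G) ^ 2
          - (α ^ 2 / (q : ℝ)) • (F⁻¹ • G) ^ 2) e
  rw [hq0] at hfin
  rw [hlhs]
  have he2 : ∑ i, (x i - xstar i) ^ 2 = ∑ i, e i ^ 2 := rfl
  rw [he2]
  have h3 : (q : ℝ)⁻¹ * (α / F * (r ⬝ᵥ W.mulVec r)) = (α / (q : ℝ)) * (r ⬝ᵥ W.mulVec r) / F := by
    ring
  rw [h3]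
  linarith
end

section
/- Let A be a real m×n matrix with nonzero rows, b ∈ ℝ^m, and x⋆ a least-squares solution (Aᵀ(b − A x⋆) = 0) with residual r⋆ = b − A x⋆. Take probabilities pᵢ = ‖Aᵢ‖²/‖A‖_F² and uniform weights wᵢ = α for some α > 0. Fix q ≥ 1 and x ∈ ℝ^n with error e = x − x⋆, and for τ : Fin q → Fin m let x'_τ = x − (α/q) Σ_{j ∈ Fin q} ((A_{τ(j)} · x − b_{τ(j)})/‖A_{τ(j)}‖²) A_{τ(j)}ᵀ. Then, writing S = AᵀA/‖A‖_F², Σ_{τ} (Π_j p_{τ(j)}) ‖x'_τ − x⋆‖² ≤ λ_max((I − α S)² + (α²/q)(I − S) S) · ‖e‖² + α² ‖r⋆‖² / (q ‖A‖_F²), where λ_max denotes the largest eigenvalue of the symmetric matrix. -/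
open Matrix BigOperators

lemma kz_moment {m : ℕ} (p h : Fin m → ℝ) (hp : ∑ i, p i = 1) (q : ℕ) :
    ∀ c : ℝ, ∑ τ : Fin q → Fin m, (∏ j, p (τ j)) * (c + ∑ j, h (τ j)) ^ 2
      = c ^ 2 + 2 * c * q * (∑ i, p i * h i) + q * (∑ i, p i * h i ^ 2)
        + q * (q - 1) * (∑ i, p i * h i) ^ 2 := by
  induction q with
  | zero => intro c; simp
  | succ q ih =>
    intro c
    rw [← (Fin.consEquiv (fun _ : Fin (q + 1) => Fin m)).sum_comp, Fintype.sum_prod_type]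
    have h1 : ∀ i : Fin m, ∑ τ : Fin q → Fin m,
        (∏ j, p ((Fin.consEquiv (fun _ : Fin (q + 1) => Fin m)) (i, τ) j)) *
          (c + ∑ j, h ((Fin.consEquiv (fun _ : Fin (q + 1) => Fin m)) (i, τ) j)) ^ 2
        = p i * ((c + h i) ^ 2 + 2 * (c + h i) * q * (∑ i, p i * h i)
          + q * (∑ i, p i * h i ^ 2) + q * (q - 1) * (∑ i, p i * h i) ^ 2) := by
      intro i
      rw [← ih (c + h i), Finset.mul_sum]
      refine Finset.sum_congr rfl fun τ _ => ?_
      simp only [Fin.consEquiv_apply, Fin.prod_univ_succ, Fin.sum_univ_succ, Fin.cons_zero,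
        Fin.cons_succ]
      ring
    rw [Finset.sum_congr rfl fun i _ => h1 i]
    generalize hμ : ∑ i, p i * h i = μ
    generalize hs : ∑ i, p i * h i ^ 2 = s
    have h2 : ∀ i, p i * ((c + h i) ^ 2 + 2 * (c + h i) * q * μ + q * s + q * (q - 1) * μ ^ 2)
      = (c ^ 2 + 2 * c * q * μ + q * s + q * (q - 1) * μ ^ 2) * p i
        + (2 * c + 2 * q * μ) * (p i * h i) + p i * h i ^ 2 := by intro i; ring
    rw [Finset.sum_congr rfl fun i _ => h2 i, Finset.sum_add_distrib, Finset.sum_add_distrib,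
      ← Finset.mul_sum, ← Finset.mul_sum, hp, hμ, hs]
    push_cast
    ring

lemma kz_quad_le {k : ℕ} (B : Matrix (Fin k) (Fin k) ℝ) (e : Fin k → ℝ) :
    e ⬝ᵥ B.mulVec e ≤ lambdaMax B * ∑ i, e i ^ 2 := by
  by_cases h0 : ∑ i, e i ^ 2 = 0
  · have he : e = 0 := by
      funext i
      have := (Finset.sum_eq_zero_iff_of_nonneg (fun i _ => sq_nonneg (e i))).1 h0 i
        (Finset.mem_univ i)
      simpa using this
    simp [he]
  have hpos : 0 < ∑ i, e i ^ 2 :=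
    lt_of_le_of_ne (Finset.sum_nonneg fun i _ => sq_nonneg _) (Ne.symm h0)
  have hbdd : BddAbove {t : ℝ | ∃ v : Fin k → ℝ, (∑ i, v i ^ 2) = 1 ∧ v ⬝ᵥ B.mulVec v = t} := by
    refine ⟨∑ i, ∑ j, |B i j|, ?_⟩
    rintro t ⟨v, hv, rfl⟩
    have hv1 : ∀ i, |v i| ≤ 1 := by
      intro i
      have : v i ^ 2 ≤ 1 := by
        rw [← hv]
        exact Finset.single_le_sum (f := fun i => v i ^ 2) (fun i _ => sq_nonneg _)
          (Finset.mem_univ i)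
      exact (sq_le_one_iff_abs_le_one _).1 this
    simp only [dotProduct, mulVec, Finset.mul_sum]
    refine Finset.sum_le_sum fun i _ => Finset.sum_le_sum fun j _ => ?_
    refine (le_abs_self _).trans ?_
    rw [abs_mul, abs_mul]
    have a := hv1 i
    have b := hv1 j
    have : |B i j| * |v j| ≤ |B i j| := mul_le_of_le_one_right (abs_nonneg _) b
    exact (mul_le_of_le_one_left (by positivity) a).trans this
  set N := ∑ i, e i ^ 2 with hN
  have hs : (√N) ^ 2 = N := Real.sq_sqrt hpos.le
  have hsn : √N ≠ 0 := (Real.sqrt_pos.2 hpos).ne'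
  have hmem : (e ⬝ᵥ B.mulVec e) / N ≤ lambdaMax B := by
    refine le_csSup hbdd ⟨(√N)⁻¹ • e, ?_, ?_⟩
    · simp only [Pi.smul_apply, smul_eq_mul, mul_pow, ← Finset.mul_sum]
      rw [← hN, inv_pow, hs, inv_mul_cancel₀ h0]
    · rw [mulVec_smul, smul_dotProduct, dotProduct_smul, smul_eq_mul, smul_eq_mul, ← mul_assoc,
        ← sq, inv_pow, hs]
      field_simp
  rwa [div_le_iff₀ hpos] at hmem

/-- Expected squared error bound for one averaged randomized Kaczmarz step with
uniform weights `wᵢ = α` and probabilities `pᵢ = ‖Aᵢ‖²/‖A‖_F²`: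
`E‖x' − x⋆‖² ≤ λ_max((I − α S)² + (α²/q)(I − S) S) ‖e‖² + α²‖r⋆‖²/(q ‖A‖_F²)`,
where `S = AᵀA/‖A‖_F²`. -/
theorem averaged_kaczmarz_uniform_weights_bound
    {m n : ℕ} (A : Matrix (Fin m) (Fin n) ℝ) (hrows : ∀ i : Fin m, A i ≠ 0)
    (b : Fin m → ℝ) (xstar : Fin n → ℝ)
    (hxstar : Aᵀ.mulVec (b - A.mulVec xstar) = 0)
    (F : ℝ) (hF : F = ∑ i, ∑ j, A i j ^ 2)
    (S : Matrix (Fin n) (Fin n) ℝ) (hS : S = F⁻¹ • (Aᵀ * A))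
    (α : ℝ) (hα : 0 < α)
    (q : ℕ) (hq : 1 ≤ q) (x : Fin n → ℝ)
    (x' : (Fin q → Fin m) → Fin n → ℝ)
    (hx' : ∀ τ, x' τ = x - (α / (q : ℝ)) •
      (∑ j : Fin q, (((∑ l, A (τ j) l * x l) - b (τ j)) / (∑ l, A (τ j) l ^ 2)) •
        A (τ j))) :
    ∑ τ : Fin q → Fin m, (∏ j, (∑ l, A (τ j) l ^ 2) / F) * (∑ i, (x' τ i - xstar i) ^ 2) ≤
      lambdaMax (((1 : Matrix (Fin n) (Fin n) ℝ) - α • S) ^ 2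
          + (α ^ 2 / (q : ℝ)) • ((1 - S) * S)) * (∑ i, (x i - xstar i) ^ 2)
        + α ^ 2 * (∑ i, ((b - A.mulVec xstar) i) ^ 2) / ((q : ℝ) * F) := by
  rcases Nat.eq_zero_or_pos m with hm | hm
  · subst hm
    have : NeZero q := ⟨by omega⟩
    have hF0 : F = 0 := by rw [hF]; simp
    have hS0 : S = 0 := by rw [hS, hF0]; simp
    have hq0 := kz_quad_le (((1 : Matrix (Fin n) (Fin n) ℝ) - α • S) ^ 2
          + (α ^ 2 / (q : ℝ)) • ((1 - S) * S)) (fun i => x i - xstar i)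
    have hnn : 0 ≤ (fun i => x i - xstar i) ⬝ᵥ ((((1 : Matrix (Fin n) (Fin n) ℝ) - α • S) ^ 2
          + (α ^ 2 / (q : ℝ)) • ((1 - S) * S)).mulVec (fun i => x i - xstar i)) := by
      rw [hS0]
      simp only [smul_zero, sub_zero, one_pow, mul_zero, add_zero, one_mulVec]
      exact Finset.sum_nonneg fun i _ => mul_self_nonneg _
    have hE : IsEmpty (Fin q → Fin 0) := ⟨fun f => (f 0).elim0⟩
    simp only [Finset.univ_eq_empty, Finset.sum_empty, hF0, mul_zero, div_zero, add_zero]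
    exact hnn.trans hq0
  have hN : ∀ i, 0 < ∑ l, A i l ^ 2 := by
    intro i
    refine lt_of_le_of_ne (Finset.sum_nonneg fun l _ => sq_nonneg _) fun h => hrows i ?_
    funext l
    have := (Finset.sum_eq_zero_iff_of_nonneg (fun l _ => sq_nonneg (A i l))).1 h.symm l
      (Finset.mem_univ l)
    simpa using this
  have hFpos : 0 < F := by
    rw [hF]
    exact Finset.sum_pos (fun i _ => hN i) ⟨⟨0, hm⟩, Finset.mem_univ _⟩
  have hF0 := hFpos.ne'
  have hq0 : (q : ℝ) ≠ 0 := by positivity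
  set N : Fin m → ℝ := fun i => ∑ l, A i l ^ 2 with hNdef
  set p : Fin m → ℝ := fun i => N i / F with hpdef
  have hp : ∑ i, p i = 1 := by
    simp only [hpdef, ← Finset.sum_div]
    rw [hF]; rw [hF] at hF0
    exact div_self hF0
  set e : Fin n → ℝ := x - xstar with he
  set r : Fin m → ℝ := b - A.mulVec xstar with hr
  set d : Fin m → ℝ := fun i => (∑ l, A i l * x l) - b i with hd
  have hde : d = A.mulVec e - r := by
    rw [he, hr, mulVec_sub]
    funext i
    simp [hd, mulVec, dotProduct]
  have hmean : ∀ k, ∑ i, p i * (d i / N i * A i k) = (S.mulVec e) k := by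
    intro k
    have h1 : S.mulVec e = F⁻¹ • Aᵀ.mulVec d := by
      rw [hde, mulVec_sub Aᵀ (A.mulVec e) r, hxstar, sub_zero, mulVec_mulVec, hS, smul_mulVec]
    rw [h1]
    simp only [Pi.smul_apply, mulVec, dotProduct, transpose_apply, smul_eq_mul, Finset.mul_sum]
    refine Finset.sum_congr rfl fun i _ => ?_
    have := (hN i).ne'
    simp only [hpdef]
    change N i ≠ 0 at this
    field_simp
  have hdd : ∑ i, d i ^ 2 = F * (e ⬝ᵥ S.mulVec e) + ∑ i, r i ^ 2 := by
    have h1 : ∀ v : Fin m → ℝ, ∑ i, v i ^ 2 = v ⬝ᵥ v := by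
      intro v; simp [dotProduct, sq]
    have h2 : A.mulVec e ⬝ᵥ r = 0 := by
      rw [dotProduct_comm, dotProduct_mulVec, ← mulVec_transpose, hxstar, zero_dotProduct]
    have h3 : A.mulVec e ⬝ᵥ A.mulVec e = F * (e ⬝ᵥ S.mulVec e) := by
      rw [hS, smul_mulVec, dotProduct_smul, smul_eq_mul, mul_inv_cancel_left₀ hF0,
        ← mulVec_mulVec, dotProduct_mulVec e, ← mulVec_transpose, transpose_transpose]
    rw [h1, h1, hde, ← h3]
    have h4 : r ⬝ᵥ A.mulVec e = 0 := by rw [dotProduct_comm]; exact h2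
    generalize A.mulVec e = w at h2 h4 ⊢
    clear_value r
    rw [sub_dotProduct, dotProduct_sub, dotProduct_sub, h2, h4]
    ring
  have hsecond : ∑ k, ∑ i, p i * (d i / N i * A i k) ^ 2
      = e ⬝ᵥ S.mulVec e + (∑ i, r i ^ 2) / F := by
    have h1 : ∀ i, ∑ k, p i * (d i / N i * A i k) ^ 2 = d i ^ 2 / F := by
      intro i
      have : N i ≠ 0 := (hN i).ne'
      have h2 : ∀ k, p i * (d i / N i * A i k) ^ 2 = (d i ^ 2 / (N i * F)) * A i k ^ 2 := by
        intro k
        simp only [hpdef]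
        field_simp
      rw [Finset.sum_congr rfl fun k _ => h2 k, ← Finset.mul_sum]
      change _ * N i = _
      field_simp
    rw [Finset.sum_comm, Finset.sum_congr rfl fun i _ => h1 i, ← Finset.sum_div, hdd]
    field_simp
  have hcoord : ∀ k, ∑ τ : Fin q → Fin m, (∏ j, p (τ j)) * (x' τ k - xstar k) ^ 2
      = e k ^ 2 - 2 * α * (e k * (S.mulVec e) k)
        + α ^ 2 / q * ∑ i, p i * (d i / N i * A i k) ^ 2
        + (α ^ 2 - α ^ 2 / q) * ((S.mulVec e) k * (S.mulVec e) k) := by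
    intro k
    have h1 := kz_moment p (fun i => -(α / q) * (d i / N i * A i k)) hp q (e k)
    have h2 : ∀ τ : Fin q → Fin m, x' τ k - xstar k
        = e k + ∑ j, -(α / q) * (d (τ j) / N (τ j) * A (τ j) k) := by
      intro τ
      rw [hx', ← Finset.mul_sum]
      simp only [Pi.sub_apply, Pi.smul_apply, Finset.sum_apply, smul_eq_mul, he, hd, hNdef]
      ring
    simp only [h2]
    rw [h1]
    have h3 : ∑ i, p i * (-(α / q) * (d i / N i * A i k)) = -(α / q) * (S.mulVec e) k := by
      rw [← hmean, Finset.mul_sum]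
      exact Finset.sum_congr rfl fun i _ => by ring
    have h4 : ∑ i, p i * (-(α / q) * (d i / N i * A i k)) ^ 2
        = (α / q) ^ 2 * ∑ i, p i * (d i / N i * A i k) ^ 2 := by
      rw [Finset.mul_sum]
      exact Finset.sum_congr rfl fun i _ => by ring
    rw [h3, h4]
    field_simp
    ring
  have hST : Sᵀ = S := by
    rw [hS, transpose_smul, transpose_mul, transpose_transpose]
  have hSS : e ⬝ᵥ S.mulVec (S.mulVec e) = S.mulVec e ⬝ᵥ S.mulVec e := by
    rw [dotProduct_mulVec, ← mulVec_transpose, hST]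
  have hB : e ⬝ᵥ ((((1 : Matrix (Fin n) (Fin n) ℝ) - α • S) ^ 2
          + (α ^ 2 / (q : ℝ)) • ((1 - S) * S)).mulVec e)
      = e ⬝ᵥ e - 2 * α * (e ⬝ᵥ S.mulVec e) + α ^ 2 / q * (e ⬝ᵥ S.mulVec e)
        + (α ^ 2 - α ^ 2 / q) * (S.mulVec e ⬝ᵥ S.mulVec e) := by
    rw [sq, add_mulVec, smul_mulVec, ← mulVec_mulVec, ← mulVec_mulVec]
    simp only [sub_mulVec, one_mulVec, smul_mulVec, mulVec_sub, mulVec_smul, dotProduct_add,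
      dotProduct_sub, dotProduct_smul, smul_eq_mul, hSS]
    ring
  have hL : ∑ τ : Fin q → Fin m, (∏ j, p (τ j)) * (∑ i, (x' τ i - xstar i) ^ 2)
      = e ⬝ᵥ ((((1 : Matrix (Fin n) (Fin n) ℝ) - α • S) ^ 2
          + (α ^ 2 / (q : ℝ)) • ((1 - S) * S)).mulVec e)
        + α ^ 2 * (∑ i, r i ^ 2) / (q * F) := by
    simp only [Finset.mul_sum (Finset.univ : Finset (Fin n))]
    rw [Finset.sum_comm, Finset.sum_congr rfl fun k _ => hcoord k, hB]
    rw [Finset.sum_add_distrib, Finset.sum_add_distrib, Finset.sum_sub_distrib,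
      ← Finset.mul_sum, ← Finset.mul_sum, ← Finset.mul_sum, hsecond]
    have h1 : ∑ k, e k ^ 2 = e ⬝ᵥ e := by simp [dotProduct, sq]
    rw [h1]
    change e ⬝ᵥ e - 2 * α * (e ⬝ᵥ S.mulVec e) + α ^ 2 / q * (e ⬝ᵥ S.mulVec e + _)
      + (α ^ 2 - α ^ 2 / q) * (S.mulVec e ⬝ᵥ S.mulVec e) = _
    field_simp
    ring
  have hfin := kz_quad_le (((1 : Matrix (Fin n) (Fin n) ℝ) - α • S) ^ 2
          + (α ^ 2 / (q : ℝ)) • ((1 - S) * S)) e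
  refine hL.le.trans ?_
  have h9 : ∑ i, (x i - xstar i) ^ 2 = ∑ i, e i ^ 2 := rfl
  rw [h9]
  linarith
end

section
/- Let A be a real m×n matrix with nonzero rows and full column rank, b ∈ ℝ^m, and x⋆ the least-squares solution (Aᵀ(b − A x⋆) = 0) with residual r⋆ = b − A x⋆. Take probabilities pᵢ = ‖Aᵢ‖²/‖A‖_F². Fix x ∈ ℝ^n with error e = x − x⋆, and for each row index i let x'_i = x − ((Aᵢ · x − bᵢ)/‖Aᵢ‖²) Aᵢᵀ be the Kaczmarz update. Then Σ_{i=1}^m pᵢ ‖x'_i − x⋆‖² ≤ (1 − σ²_min(A)/‖A‖_F²) ‖e‖² + ‖r⋆‖²/‖A‖_F², where σ²_min(A) is the smallest eigenvalue of AᵀA. -/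
open Matrix BigOperators

/-- The smallest eigenvalue of a symmetric matrix, as the infimum of the quadratic form
`⟨v, B v⟩` over Euclidean unit vectors `v`.  For `B = AᵀA` this is `σ²_min(A)`, the square of
the smallest singular value of `A`. -/
noncomputable def lambdaMin {k : ℕ} (B : Matrix (Fin k) (Fin k) ℝ) : ℝ :=
  sInf {t : ℝ | ∃ v : Fin k → ℝ, (∑ i, v i ^ 2) = 1 ∧ v ⬝ᵥ B.mulVec v = t}

theorem lambdaMin_le_aux {m n : ℕ} (A : Matrix (Fin m) (Fin n) ℝ) (e : Fin n → ℝ) :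
    lambdaMin (Aᵀ * A) * (∑ l, e l ^ 2) ≤ ∑ i, (A.mulVec e i) ^ 2 := by
  have quad : ∀ v : Fin n → ℝ, v ⬝ᵥ (Aᵀ * A).mulVec v = ∑ i, (A.mulVec v i) ^ 2 := by
    intro v
    rw [← Matrix.mulVec_mulVec, Matrix.dotProduct_mulVec, Matrix.vecMul_transpose]
    simp [dotProduct, sq]
  rcases (Finset.sum_nonneg (fun l (_ : l ∈ Finset.univ) => sq_nonneg (e l))).eq_or_lt with h | h
  · rw [← h, mul_zero]
    exact Finset.sum_nonneg (fun i _ => sq_nonneg _)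
  · set N := ∑ l, e l ^ 2 with hN
    rw [← le_div_iff₀ h]
    apply csInf_le
    · refine ⟨0, ?_⟩
      rintro t ⟨v, -, rfl⟩
      rw [quad]
      exact Finset.sum_nonneg (fun i _ => sq_nonneg _)
    · refine ⟨(Real.sqrt N)⁻¹ • e, ?_, ?_⟩
      · simp only [Pi.smul_apply, smul_eq_mul, mul_pow, inv_pow, Real.sq_sqrt h.le]
        rw [← Finset.mul_sum, ← hN, inv_mul_cancel₀ h.ne']
      · rw [quad]
        simp only [Matrix.mulVec_smul, Pi.smul_apply, smul_eq_mul, mul_pow, inv_pow,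
          Real.sq_sqrt h.le]
        rw [← Finset.mul_sum, div_eq_inv_mul]

/-- Per-step expected error bound for the randomized Kaczmarz method with
probabilities `pᵢ = ‖Aᵢ‖²/‖A‖_F²`:
`Σᵢ pᵢ ‖x'ᵢ − x⋆‖² ≤ (1 − σ²_min(A)/‖A‖_F²) ‖e‖² + ‖r⋆‖²/‖A‖_F²`. -/
theorem randomized_kaczmarz_expected_error_bound
    {m n : ℕ} (A : Matrix (Fin m) (Fin n) ℝ) (hrows : ∀ i : Fin m, A i ≠ 0)
    (hrank : A.rank = n)
    (b : Fin m → ℝ) (xstar : Fin n → ℝ)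
    (hxstar : Aᵀ.mulVec (b - A.mulVec xstar) = 0)
    (F : ℝ) (hF : F = ∑ i, ∑ j, A i j ^ 2)
    (x : Fin n → ℝ)
    (x' : Fin m → Fin n → ℝ)
    (hx' : ∀ i, x' i = x - (((∑ l, A i l * x l) - b i) / (∑ l, A i l ^ 2)) • A i) :
    ∑ i : Fin m, ((∑ l, A i l ^ 2) / F) * (∑ l, (x' i l - xstar l) ^ 2) ≤
      (1 - lambdaMin (Aᵀ * A) / F) * (∑ l, (x l - xstar l) ^ 2)
        + (∑ i, ((b - A.mulVec xstar) i) ^ 2) / F := by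
  have hs : ∀ i, 0 < ∑ l, A i l ^ 2 := by
    intro i
    obtain ⟨j, hj⟩ := Function.ne_iff.mp (hrows i)
    exact Finset.sum_pos' (fun l _ => sq_nonneg _) ⟨j, Finset.mem_univ _, by
      have : A i j ≠ 0 := hj
      positivity⟩
  rcases Nat.eq_zero_or_pos m with hm | hm
  · subst hm
    have hn : n = 0 := by
      have := A.rank_le_height
      omega
    subst hn
    simp
  have hFpos : 0 < F := by
    rw [hF]
    exact Finset.sum_pos (fun i _ => hs i) ⟨⟨0, hm⟩, Finset.mem_univ _⟩
  have key := lambdaMin_le_aux A (x - xstar)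
  simp only [Pi.sub_apply] at key
  have step : ∀ i, (∑ l, A i l ^ 2) * (∑ l, (x' i l - xstar l) ^ 2) =
      (∑ l, A i l ^ 2) * (∑ l, (x l - xstar l) ^ 2) - (A.mulVec (x - xstar) i) ^ 2
        + ((b - A.mulVec xstar) i) ^ 2 := by
    intro i
    have h1 : A.mulVec (x - xstar) i = ∑ l, A i l * (x l - xstar l) := rfl
    have h2 : (b - A.mulVec xstar) i = b i - ∑ l, A i l * xstar l := rfl
    have h3 : ∑ l, A i l * (x l - xstar l) = ∑ l, A i l * x l - ∑ l, A i l * xstar l := by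
      simp only [mul_sub, Finset.sum_sub_distrib]
    have h4 : ∀ c : ℝ, ∑ l, ((x - c • A i) l - xstar l) ^ 2 =
        ∑ l, (x l - xstar l) ^ 2 - 2 * c * ∑ l, A i l * (x l - xstar l)
          + c ^ 2 * ∑ l, A i l ^ 2 := by
      intro c
      rw [Finset.mul_sum, Finset.mul_sum, ← Finset.sum_sub_distrib, ← Finset.sum_add_distrib]
      refine Finset.sum_congr rfl fun l _ => ?_
      simp only [Pi.sub_apply, Pi.smul_apply, smul_eq_mul]
      ring
    rw [hx' i, h4, h1, h2, h3]
    have := (hs i).ne'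
    field_simp
    ring
  have tot : ∑ i : Fin m, ((∑ l, A i l ^ 2) / F) * (∑ l, (x' i l - xstar l) ^ 2) =
      (F * (∑ l, (x l - xstar l) ^ 2) - ∑ i, (A.mulVec (x - xstar) i) ^ 2
        + ∑ i, ((b - A.mulVec xstar) i) ^ 2) / F := by
    simp only [div_mul_eq_mul_div, step]
    rw [← Finset.sum_div, Finset.sum_add_distrib, Finset.sum_sub_distrib, ← Finset.sum_mul, ← hF]
  rw [tot, div_le_iff₀ hFpos]
  have : ((1 - lambdaMin (Aᵀ * A) / F) * (∑ l, (x l - xstar l) ^ 2)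
        + (∑ i, ((b - A.mulVec xstar) i) ^ 2) / F) * F =
      F * (∑ l, (x l - xstar l) ^ 2) - lambdaMin (Aᵀ * A) * (∑ l, (x l - xstar l) ^ 2)
        + ∑ i, ((b - A.mulVec xstar) i) ^ 2 := by
    field_simp
  rw [this]
  linarith
end

section
/- Fix a natural number q ≥ 1 and reals s_min, s_max with 0 < s_min ≤ s_max < 1, and for α > 0 define p_α(σ) = 1 − 2ασ + α²(σ/q + (1 − 1/q)σ²) and f(α) = max(p_α(s_min), p_α(s_max)). Define α⋆ = q/(1 + (q−1)s_min) if 1 − (q−1)(s_max − s_min) ≥ 0, and α⋆ = 2q/(1 + (q−1)(s_min + s_max)) if 1 − (q−1)(s_max − s_min) < 0. Then for every α > 0, f(α⋆) ≤ f(α); that is, α⋆ minimizes f over positive reals. -/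
/-- The relaxation parameter `α⋆` minimizes the convergence-rate bound
`f(α) = max(p_α(s_min), p_α(s_max))` over positive reals, where
`p_α(σ) = 1 − 2ασ + α²(σ/q + (1 − 1/q)σ²)`, and `α⋆ = q/(1 + (q−1)s_min)` if
`1 − (q−1)(s_max − s_min) ≥ 0`, and `α⋆ = 2q/(1 + (q−1)(s_min + s_max))` otherwise. -/
theorem optimal_relaxation_parameter
    (q : ℕ) (hq : 1 ≤ q) (smin smax : ℝ)
    (hsmin : 0 < smin) (hs : smin ≤ smax) (hsmax : smax < 1)
    (P : ℝ → ℝ → ℝ)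
    (hP : ∀ α σ, P α σ = 1 - 2 * α * σ + α ^ 2 * (σ / (q : ℝ) + (1 - 1 / (q : ℝ)) * σ ^ 2))
    (f : ℝ → ℝ) (hf : ∀ α, f α = max (P α smin) (P α smax))
    (αstar : ℝ)
    (hαstar : αstar =
      if 0 ≤ 1 - ((q : ℝ) - 1) * (smax - smin)
      then (q : ℝ) / (1 + ((q : ℝ) - 1) * smin)
      else 2 * (q : ℝ) / (1 + ((q : ℝ) - 1) * (smin + smax))) :
    ∀ α : ℝ, 0 < α → f αstar ≤ f α := by
  intro α hα
  have hq1 : (1:ℝ) ≤ (q:ℝ) := by exact_mod_cast hq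
  have hq0 : (0:ℝ) < (q:ℝ) := by linarith
  obtain ⟨k, hk⟩ : ∃ k : ℝ, k = (q:ℝ) - 1 := ⟨_, rfl⟩
  have hk0 : 0 ≤ k := by linarith
  rw [← hk] at hαstar
  have hb : 0 < smax := by linarith
  have hka : 0 ≤ k * smin := by positivity
  have hkb : 0 ≤ k * smax := by positivity
  have hkab : k * smin ≤ k * smax := mul_le_mul_of_nonneg_left hs hk0
  have key : ∀ β σ, P (q * β) σ = 1 + q * (σ * (β ^ 2 * (1 + k * σ) - 2 * β)) := by
    intro β σ
    rw [hP, hk]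
    field_simp
    ring
  have diff : ∀ β γ σ, P (q * β) σ - P (q * γ) σ
      = q * σ * ((β - γ) * ((β + γ) * (1 + k * σ) - 2)) := by
    intro β γ σ
    rw [key, key]
    ring
  have diff2 : ∀ β, P (q * β) smin - P (q * β) smax
      = q * ((smax - smin) * (β * (2 - β * (1 + k * (smin + smax))))) := by
    intro β
    rw [key, key]
    ring
  obtain ⟨β, hβ⟩ : ∃ β, α = q * β := ⟨α / q, by field_simp⟩
  have hs' : 0 ≤ smax - smin := by linarith
  rw [hf, hf]
  split_ifs at hαstar with h
  · obtain ⟨γ, hγ⟩ : ∃ γ, γ = 1 / (1 + k * smin) := ⟨_, rfl⟩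
    have hγ0 : 0 < γ := by rw [hγ]; positivity
    have hγ1 : γ * (1 + k * smin) = 1 := by rw [hγ]; field_simp
    have e : αstar = q * γ := by rw [hαstar, hγ]; ring
    rw [e, hβ]
    have h1 : 0 ≤ 2 - γ * (1 + k * (smin + smax)) := by
      have : 2 - γ * (1 + k * (smin + smax)) = γ * (1 - k * (smax - smin)) := by
        linear_combination (-2) * hγ1
      rw [this]
      exact mul_nonneg hγ0.le h
    have h2 : 0 ≤ P (q * γ) smin - P (q * γ) smax := by
      rw [diff2]; positivity
    have h3 : 0 ≤ P (q * β) smin - P (q * γ) smin := by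
      have : (β - γ) * ((β + γ) * (1 + k * smin) - 2) = (β - γ) ^ 2 * (1 + k * smin) := by
        linear_combination 2 * (β - γ) * hγ1
      rw [diff, this]; positivity
    refine le_trans (max_le ?_ ?_) (le_max_left _ _) <;> linarith
  · obtain ⟨γ, hγ⟩ : ∃ γ, γ = 2 / (1 + k * (smin + smax)) := ⟨_, rfl⟩
    have hγ0 : 0 < γ := by rw [hγ]; positivity
    have hγ1 : γ * (1 + k * (smin + smax)) = 2 := by rw [hγ]; field_simp
    have e : αstar = q * γ := by rw [hαstar, hγ]; ring
    rw [e, hβ]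
    have h2 : P (q * γ) smin - P (q * γ) smax = 0 := by
      rw [diff2, hγ1]; ring
    have h' : 0 ≤ k * (smax - smin) - 1 := by linarith
    have h4 := mul_nonneg hγ0.le h'
    rcases le_total γ β with hle | hle
    · have h5 : 0 ≤ (β - γ) * ((β + γ) * (1 + k * smax) - 2) := by
        have := mul_nonneg (sub_nonneg.2 hle) (by positivity : 0 ≤ 1 + k * smax)
        refine mul_nonneg (by linarith) ?_
        nlinarith
      have h3 : 0 ≤ P (q * β) smax - P (q * γ) smax := by
        rw [diff]; positivity
      refine le_trans (max_le ?_ ?_) (le_max_right _ _) <;> linarith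
    · have h5 : 0 ≤ (β - γ) * ((β + γ) * (1 + k * smin) - 2) := by
        have := mul_nonneg (sub_nonneg.2 hle) (by positivity : 0 ≤ 1 + k * smin)
        refine mul_nonneg_of_nonpos_of_nonpos (by linarith) ?_
        nlinarith
      have h3 : 0 ≤ P (q * β) smin - P (q * γ) smin := by
        rw [diff]; positivity
      refine le_trans (max_le ?_ ?_) (le_max_left _ _) <;> linarith
end
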